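/- Let A be a C*-algebra, M a Hilbert A-module, and N ⊆ M a Hilbert A-submodule. Suppose φ : N' → M' is an isometric A-linear embedding which extends the canonical embedding of N into M', i.e., φ(⟨·,n⟩_N) = ⟨·,n⟩_M for every n ∈ N. Then for every r ∈ N', the map φ(r) ∈ M' vanishes on N^⊥ ⊆ M: φ(r)(x) = 0 for all x ∈ N^⊥. -/

import Mathlib

noncomputable section

open scoped ENNReal MultiplierAlgebra

universe u v w

/-- A (left) Hilbert C*-module over a (not necessarily unital) C*-algebra `A`:
a Banach space `M` which is a (nonunital) left `A`-module equipped with an `A`-valued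
inner product, `A`-linear in the first variable, satisfying `⟨x,y⟩ = ⟨y,x⟩*`,
`⟨x,x⟩ ≥ 0` (i.e. of the form `b* b`), definiteness, and such that the norm of `M`
satisfies `‖x‖ = ‖⟨x,x⟩‖ ^ (1/2)` and `M` is complete. -/
class HilbertCStarModule (A : Type u) (M : Type v) [NonUnitalCStarAlgebra A]
    [NormedAddCommGroup M] [NormedSpace ℂ M] [SMul A M] where
  inner : M → M → A
  smul_add' : ∀ (a : A) (x y : M), a • (x + y) = a • x + a • y
  add_smul' : ∀ (a b : A) (x : M), (a + b) • x = a • x + b • x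
  mul_smul' : ∀ (a b : A) (x : M), (a * b) • x = a • (b • x)
  smul_smul' : ∀ (c : ℂ) (a : A) (x : M), (c • a) • x = c • (a • x)
  inner_add_left : ∀ x y z : M, inner (x + y) z = inner x z + inner y z
  inner_smulA_left : ∀ (a : A) (x y : M), inner (a • x) y = a * inner x y
  inner_smulC_left : ∀ (c : ℂ) (x y : M), inner (c • x) y = c • inner x y
  inner_conj : ∀ x y : M, inner x y = star (inner y x)
  inner_self_pos : ∀ x : M, ∃ b : A, inner x x = star b * b
  inner_self_eq_zero : ∀ x : M, inner x x = 0 ↔ x = 0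
  norm_eq : ∀ x : M, ‖x‖ = Real.sqrt ‖inner x x‖
  complete : CompleteSpace M

section Defs

variable (A : Type u) [NonUnitalCStarAlgebra A] {M : Type v}
  [NormedAddCommGroup M] [NormedSpace ℂ M] [SMul A M]

/-- The `A`-valued inner product of a Hilbert C*-module. -/
def hInner [HilbertCStarModule A M] (x y : M) : A := HilbertCStarModule.inner x y

/-- The orthogonal complement `S^⊥ = {x | ⟨x, s⟩ = 0 for all s ∈ S}` of a subset `S`. -/
def orthComp [HilbertCStarModule A M] (S : Set M) : Set M :=
  {x : M | ∀ s ∈ S, hInner A x s = 0}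

/-- A Hilbert C*-submodule: a norm-closed subset which is closed under addition and under
the actions of `ℂ` and `A`. -/
structure IsHilbertSubmodule (N : Set M) : Prop where
  isClosed : IsClosed N
  zero_mem : (0 : M) ∈ N
  add_mem : ∀ ⦃x y : M⦄, x ∈ N → y ∈ N → x + y ∈ N
  smulC_mem : ∀ (c : ℂ) ⦃x : M⦄, x ∈ N → c • x ∈ N
  smulA_mem : ∀ (a : A) ⦃x : M⦄, x ∈ N → a • x ∈ N

end Defs

section Maps

variable (A : Type u) [NonUnitalCStarAlgebra A] {M : Type v} {M₂ : Type w}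
  [NormedAddCommGroup M] [NormedSpace ℂ M] [SMul A M]
  [NormedAddCommGroup M₂] [NormedSpace ℂ M₂] [SMul A M₂]

/-- A bounded `A`-linear map between (left) normed `A`-modules. -/
structure IsBoundedModuleMap (T : M → M₂) : Prop where
  map_add : ∀ x y : M, T (x + y) = T x + T y
  map_smulC : ∀ (c : ℂ) (x : M), T (c • x) = c • T x
  map_smulA : ∀ (a : A) (x : M), T (a • x) = a • T x
  bound : ∃ C : ℝ, ∀ x : M, ‖T x‖ ≤ C * ‖x‖

/-- The operator norm of a map between normed modules. -/
def opNorm (T : M → M₂) : ℝ :=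
  sInf {c : ℝ | 0 ≤ c ∧ ∀ x : M, ‖T x‖ ≤ c * ‖x‖}

end Maps

section Dual

variable (A : Type u) [NonUnitalCStarAlgebra A] {M : Type v}
  [NormedAddCommGroup M] [NormedSpace ℂ M] [SMul A M]

/-- A bounded `A`-linear map `M → A`, i.e. an element of the `A`-dual `M'`. -/
structure IsDualVector (r : M → A) : Prop where
  map_add : ∀ x y : M, r (x + y) = r x + r y
  map_smulC : ∀ (c : ℂ) (x : M), r (c • x) = c • r x
  map_smulA : ∀ (a : A) (x : M), r (a • x) = a * r x
  bound : ∃ C : ℝ, ∀ x : M, ‖r x‖ ≤ C * ‖x‖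

/-- The norm of an element of the `A`-dual. -/
def dualNorm (r : M → A) : ℝ :=
  sInf {c : ℝ | 0 ≤ c ∧ ∀ x : M, ‖r x‖ ≤ c * ‖x‖}

/-- A function `r : M → A` which restricts to a bounded `A`-linear map on the subset `S`;
this represents an element of the `A`-dual `S'` of the submodule `S` (only the values on `S`
are relevant). -/
structure IsDualVectorOn (S : Set M) (r : M → A) : Prop where
  map_add : ∀ x ∈ S, ∀ y ∈ S, r (x + y) = r x + r y
  map_smulC : ∀ (c : ℂ), ∀ x ∈ S, r (c • x) = c • r x
  map_smulA : ∀ (a : A), ∀ x ∈ S, r (a • x) = a * r x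
  bound : ∃ C : ℝ, ∀ x ∈ S, ‖r x‖ ≤ C * ‖x‖

/-- The norm of a bounded `A`-linear map given on the subset `S`. -/
def dualNormOn (S : Set M) (r : M → A) : ℝ :=
  sInf {c : ℝ | 0 ≤ c ∧ ∀ x ∈ S, ‖r x‖ ≤ c * ‖x‖}

/-- The canonical embedding of `M` into its `A`-dual: `x ↦ ⟨·, x⟩`. -/
def toDualFun [HilbertCStarModule A M] (x : M) : M → A := fun y => hInner A y x

/-- The canonical evaluation map of `M` into its `A`-bidual: `Ω x : r ↦ r x`. -/
def omegaFun (x : M) : (M → A) → A := fun r => r x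

/-- A bounded `A`-linear functional on the `A`-dual `M'`, i.e. an element of the
`A`-bidual `M''`.  Here `M'` carries the `A`-action `(a • r) x = r x * (star a)`, and the
corresponding `A`-linearity for functionals on `M'` reads `F (a • r) = F r * star a`
(which holds for all evaluation functionals `Ω x`). -/
structure IsBidualVector (F : (M → A) → A) : Prop where
  map_add : ∀ r s : M → A, IsDualVector A r → IsDualVector A s →
    F (fun x => r x + s x) = F r + F s
  map_smulC : ∀ (c : ℂ) (r : M → A), IsDualVector A r →
    F (fun x => c • r x) = c • F r
  map_smulA : ∀ (a : A) (r : M → A), IsDualVector A r →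
    F (fun x => r x * star a) = F r * star a
  bound : ∃ C : ℝ, ∀ r : M → A, IsDualVector A r → ‖F r‖ ≤ C * dualNorm A r

/-- The norm of an element of the `A`-bidual. -/
def bidualNorm (F : (M → A) → A) : ℝ :=
  sInf {c : ℝ | 0 ≤ c ∧ ∀ r : M → A, IsDualVector A r → ‖F r‖ ≤ c * dualNorm A r}

/-- An element of the `A`-bidual `S''` of a submodule `S ⊆ M`, represented as a functional
on (representatives of) elements of the `A`-dual `S'`. -/
structure IsBidualVectorOn (S : Set M) (F : (M → A) → A) : Prop where
  congr : ∀ r s : M → A, IsDualVectorOn A S r → IsDualVectorOn A S s →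
    (∀ x ∈ S, r x = s x) → F r = F s
  map_add : ∀ r s : M → A, IsDualVectorOn A S r → IsDualVectorOn A S s →
    F (fun x => r x + s x) = F r + F s
  map_smulC : ∀ (c : ℂ) (r : M → A), IsDualVectorOn A S r →
    F (fun x => c • r x) = c • F r
  map_smulA : ∀ (a : A) (r : M → A), IsDualVectorOn A S r →
    F (fun x => r x * star a) = F r * star a
  bound : ∃ C : ℝ, ∀ r : M → A, IsDualVectorOn A S r → ‖F r‖ ≤ C * dualNormOn A S r

/-- The norm of an element of the `A`-bidual of a submodule `S`. -/
def bidualNormOn (S : Set M) (F : (M → A) → A) : ℝ :=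
  sInf {c : ℝ | 0 ≤ c ∧ ∀ r : M → A, IsDualVectorOn A S r → ‖F r‖ ≤ c * dualNormOn A S r}

/-- `M` is `A`-reflexive if the canonical map `Ω : M → M''` is surjective. -/
def IsCReflexive [HilbertCStarModule A M] : Prop :=
  ∀ F : (M → A) → A, IsBidualVector A F →
    ∃ x : M, ∀ r : M → A, IsDualVector A r → F r = r x

end Dual

section Order

/-- The C*-order relation: `x ≤ y` iff `y - x` is positive, i.e. of the form `c* c`. -/
def cstarLE {B : Type*} [NonUnitalRing B] [Star B] (x y : B) : Prop :=
  ∃ c : B, y - x = star c * c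

/-- `m` is the least upper bound of `S` with respect to the C*-order. -/
def IsCStarLUB {B : Type*} [NonUnitalRing B] [Star B] (S : Set B) (m : B) : Prop :=
  (∀ b ∈ S, cstarLE b m) ∧ ∀ u : B, (∀ b ∈ S, cstarLE b u) → cstarLE m u

/-- A C*-algebra is monotone complete if every norm-bounded increasingly directed set of
self-adjoint elements has a least upper bound. -/
def MonotoneComplete (B : Type*) [NonUnitalNormedRing B] [StarRing B] : Prop :=
  ∀ S : Set B, S.Nonempty → (∀ b ∈ S, star b = b) →
    (∀ x ∈ S, ∀ y ∈ S, ∃ z ∈ S, cstarLE x z ∧ cstarLE y z) →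
    (∃ C : ℝ, ∀ b ∈ S, ‖b‖ ≤ C) →
    ∃ m : B, IsCStarLUB S m

/-- A C*-algebra is additively complete if every family of positive elements whose finite
partial sums are norm-bounded has a least upper bound (of the set of its finite partial
sums). -/
def AdditivelyComplete (B : Type w) [NonUnitalNormedRing B] [StarRing B] : Prop :=
  ∀ (ι : Type w) (f : ι → B), (∀ i, ∃ c : B, f i = star c * c) →
    (∃ C : ℝ, ∀ s : Finset ι, ‖∑ i ∈ s, f i‖ ≤ C) →
    ∃ m : B, IsCStarLUB {b : B | ∃ s : Finset ι, b = ∑ i ∈ s, f i} m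

end Order

/-- The Hahn-Banach type extension property of a C*-algebra `A`: for every Hilbert
`A`-module `M` and every Hilbert `A`-submodule `N ⊆ M`, every bounded `A`-linear map
`r : N → A` extends to a bounded `A`-linear map `r' : M → A` with the same norm, with
`r'` restricted to `N` equal to `r` and `r'` vanishing on `N^⊥`. -/
def ExtensionProperty (A : Type u) [NonUnitalCStarAlgebra A] : Prop :=
  ∀ (M : Type v) [NormedAddCommGroup M] [NormedSpace ℂ M] [SMul A M]
    [HilbertCStarModule A M] (N : Set M), IsHilbertSubmodule A N →
    ∀ r : M → A, IsDualVectorOn A N r →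
      ∃ r' : M → A, IsDualVector A r' ∧ dualNorm A r' = dualNormOn A N r ∧
        (∀ x ∈ N, r' x = r x) ∧ (∀ x ∈ orthComp A N, r' x = 0)

section CStar

variable {A : Type*} [NonUnitalCStarAlgebra A]

theorem Unitization.exists_inr_eq_mul_inr (u : Unitization ℂ A) (a : A) :
    ∃ c : A, (c : Unitization ℂ A) = u * a :=
  ⟨u.fst • a + u.snd * a, by ext <;> simp⟩

variable [PartialOrder A] [StarOrderedRing A]

/-- An order relation between positive elements follows from norm bounds on all conjugates. -/
theorem le_smul_of_norm_conjugate_le {p q : A} (hp : 0 ≤ p) (hq : 0 ≤ q) {K : ℝ} (hK : 0 ≤ K)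
    (h : ∀ e : A, ‖star e * p * e‖ ≤ K * ‖star e * q * e‖) : p ≤ K • q := by
  have hKq : 0 ≤ K • q := smul_nonneg hK hq
  rw [← Unitization.inr_le_iff p (K • q) (.of_nonneg hp) (.of_nonneg hKq)]
  have hKq' : (0 : Unitization ℂ A) ≤ ((K • q : A) : Unitization ℂ A) :=
    Unitization.inr_nonneg_iff.2 hKq
  have hp' : (0 : Unitization ℂ A) ≤ (p : Unitization ℂ A) := Unitization.inr_nonneg_iff.2 hp
  suffices H : ∀ ε : ℝ, 0 < ε → (p : Unitization ℂ A) ≤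
      ((K • q : A) : Unitization ℂ A) + algebraMap ℝ _ ε by
    have hc : Filter.Tendsto (fun ε : ℝ => ((K • q : A) : Unitization ℂ A) + algebraMap ℝ _ ε)
        (nhdsWithin 0 (Set.Ioi 0)) (nhds (((K • q : A) : Unitization ℂ A) + algebraMap ℝ _ 0)) :=
      ((continuous_const.add (continuous_algebraMap ℝ _)).tendsto 0).mono_left nhdsWithin_le_nhds
    rw [map_zero, add_zero] at hc
    exact ge_of_tendsto hc (by filter_upwards [self_mem_nhdsWithin] with ε hε using H ε hε)
  intro ε hε
  set W : Unitization ℂ A := ((K • q : A) : Unitization ℂ A) + algebraMap ℝ _ ε with hW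
  have hεpos : IsStrictlyPositive (algebraMap ℝ (Unitization ℂ A) ε) :=
    IsStrictlyPositive.iff_of_unital.2
      ⟨algebraMap_nonneg _ hε.le, (isUnit_iff_ne_zero.2 hε.ne').map _⟩
  have hWpos : IsStrictlyPositive W :=
    IsStrictlyPositive.iff_of_unital.2 ⟨add_nonneg hKq' hεpos.nonneg,
      CStarAlgebra.isUnit_of_le _ (le_add_of_nonneg_left hKq') hεpos⟩
  rw [le_iff_norm_sqrt_mul_rpow _ W hp' hWpos]
  set e := W ^ (-(1 / 2) : ℝ) with he
  have hestar : star e = e := IsSelfAdjoint.of_nonneg CFC.rpow_nonneg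
  have heWe : e * W * e = 1 := CFC.conjugate_rpow_neg_one_half W hWpos
  have hsq : CFC.sqrt (p : Unitization ℂ A) = ((CFC.sqrt p : A) : Unitization ℂ A) :=
    Unitization.sqrt_inr
  set s : A := CFC.sqrt p
  have hs : star s = s := IsSelfAdjoint.of_nonneg (CFC.sqrt_nonneg p)
  have hss : s * s = p := CFC.sqrt_mul_sqrt_self p
  obtain ⟨y, hy⟩ := Unitization.exists_inr_eq_mul_inr e s
  obtain ⟨f, hf⟩ := Unitization.exists_inr_eq_mul_inr e y
  have hy' : ((star y : A) : Unitization ℂ A) = s * e := by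
    rw [Unitization.inr_star, hy, star_mul, hestar, ← Unitization.inr_star, hs]
  have hf' : ((star f : A) : Unitization ℂ A) = star y * e := by
    rw [Unitization.inr_star, hf, star_mul, hestar, ← Unitization.inr_star]
  rw [hsq, ← hy', Unitization.norm_inr, norm_star]
  have h1 : star f * p * f = star (star y * y) * (star y * y) := by
    apply Unitization.inr_injective (R := ℂ)
    simp only [Unitization.inr_mul, hf, hf', ← hss, star_mul, star_star, hy', hy, mul_assoc]
  have h2 : K * ‖star f * q * f‖ ≤ ‖y‖ ^ 2 := by
    have h4 : K * ‖star f * q * f‖ = ‖star f * (K • q) * f‖ := by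
      rw [mul_smul_comm, smul_mul_assoc, norm_smul, Real.norm_of_nonneg hK]
    have h5 : ((star f * (K • q) * f : A) : Unitization ℂ A) =
        star y * (e * (K • q : A) * e) * y := by
      rw [Unitization.inr_mul, Unitization.inr_mul, hf, hf']
      simp only [mul_assoc, Unitization.inr_star]
    have h6 : ‖e * ((K • q : A) : Unitization ℂ A) * e‖ ≤ 1 := by
      have hnonneg : 0 ≤ e * ((K • q : A) : Unitization ℂ A) * e :=
        conjugate_nonneg_of_nonneg hKq' CFC.rpow_nonneg
      rw [CStarAlgebra.norm_le_one_iff_of_nonneg _ hnonneg, ← heWe]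
      exact conjugate_le_conjugate_of_nonneg (le_add_of_nonneg_right hεpos.nonneg)
        CFC.rpow_nonneg
    rw [h4, ← Unitization.norm_inr (𝕜 := ℂ), h5, Unitization.inr_star]
    calc _ ≤ ‖(star y : Unitization ℂ A)‖ * ‖e * ((K • q : A) : Unitization ℂ A) * e‖ *
          ‖(y : Unitization ℂ A)‖ := norm_mul₃_le
      _ ≤ ‖(star y : Unitization ℂ A)‖ * 1 * ‖(y : Unitization ℂ A)‖ := by gcongr
      _ = ‖y‖ ^ 2 := by rw [norm_star, Unitization.norm_inr]; ring
  have h3 := h f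
  rw [h1, CStarRing.norm_star_mul_self, CStarRing.norm_star_mul_self] at h3
  have h4 := h3.trans h2
  by_contra! hlt
  have h5 : 1 < ‖y‖ ^ 2 := one_lt_pow₀ hlt two_ne_zero
  nlinarith

/-- A positive element is approximated by an element supported where it is at least `ε`. -/
theorem exists_spectral_cutoff {z : A} (hz : 0 ≤ z) {ε : ℝ} (hε : 0 < ε) :
    ∃ k j : A, star k = k ∧ k * z * j = k ∧ ‖z - k‖ ≤ ε ∧ ε • (k * k) ≤ k * z * k := by
  have hsa : IsSelfAdjoint z := .of_nonneg hz
  let f : ℝ → ℝ := fun u => max (u - ε) 0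
  let g : ℝ → ℝ := fun u => u / (max u ε) ^ 2
  have hf : Continuous f := by fun_prop
  have hg : Continuous g := by
    refine continuous_id.div (by fun_prop) fun u => ?_
    have : 0 < max u ε := lt_max_of_lt_right hε
    positivity
  have hf0 : f 0 = 0 := by simp [f, hε.le]
  have hg0 : g 0 = 0 := by simp [g]
  have hid : cfcₙ (fun u : ℝ => u) z = z := cfcₙ_id' ℝ z
  refine ⟨cfcₙ f z, cfcₙ g z, ?_, ?_, ?_, ?_⟩
  · exact cfcₙ_predicate f z
  · nth_rw 2 [← hid]
    rw [← cfcₙ_mul f (fun u => u) z, ← cfcₙ_mul (fun u => f u * u) g z (by fun_prop) (by simp)]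
    refine cfcₙ_congr fun u _ => ?_
    rcases le_total u ε with h | h
    · simp [f, h]
    · have : u ≠ 0 := (hε.trans_le h).ne'
      simp only [g, max_eq_left h]
      field_simp
  · nth_rw 1 [← hid]
    rw [← cfcₙ_sub (fun u => u) f z]
    refine norm_cfcₙ_le fun u hu => ?_
    have hu0 : 0 ≤ u := quasispectrum_nonneg_of_nonneg z hz u hu
    rcases le_total u ε with h | h
    · simp [f, h, abs_of_nonneg hu0]
    · simp [f, h, abs_of_pos hε]
  · nth_rw 4 [← hid]
    rw [← cfcₙ_mul f (fun u => u) z, ← cfcₙ_mul (fun u => f u * u) f z (by fun_prop) (by simp),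
      ← cfcₙ_mul f f z, ← cfcₙ_smul ε (fun u => f u * f u) z]
    refine cfcₙ_mono fun u _ => ?_
    rcases le_total u ε with h | h
    · simp [f, h]
    · simp only [f, max_eq_left (sub_nonneg.2 h), smul_eq_mul]
      nlinarith [sq_nonneg (u - ε), mul_nonneg (sub_nonneg.2 h) (sq_nonneg (u - ε))]

end CStar

section HilbertModule

variable {A : Type u} [NonUnitalCStarAlgebra A] {M : Type v} [NormedAddCommGroup M]
  {N S : Set M} {r s τ : M → A}

theorem dualNormOn_le {c : ℝ} (hc : 0 ≤ c) (h : ∀ x ∈ S, ‖r x‖ ≤ c * ‖x‖) :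
    dualNormOn A S r ≤ c :=
  csInf_le ⟨0, fun _ hb => hb.1⟩ ⟨hc, h⟩

theorem dualNormOn_univ (r : M → A) : dualNormOn A Set.univ r = dualNorm A r := by
  simp [dualNormOn, dualNorm]

theorem dualNorm_le {c : ℝ} (hc : 0 ≤ c) (h : ∀ x, ‖r x‖ ≤ c * ‖x‖) : dualNorm A r ≤ c := by
  rw [← dualNormOn_univ]
  exact dualNormOn_le hc fun x _ => h x

theorem dualNormOn_congr (h : ∀ x ∈ S, r x = s x) :
    dualNormOn A S r = dualNormOn A S s := by
  unfold dualNormOn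
  congr 1
  ext c
  exact and_congr_right fun _ => forall₂_congr fun x hx => by rw [h x hx]

variable [NormedSpace ℂ M] [SMul A M]

theorem IsDualVectorOn.norm_apply_le (h : IsDualVectorOn A S r) {x : M} (hx : x ∈ S) :
    ‖r x‖ ≤ dualNormOn A S r * ‖x‖ := by
  obtain ⟨C, hC⟩ := h.bound
  rcases eq_or_ne x 0 with rfl | h0
  · simpa using hC 0 hx
  · have hpos : 0 < ‖x‖ := norm_pos_iff.2 h0
    rw [← div_le_iff₀ hpos]
    refine le_csInf ⟨|C|, abs_nonneg C, fun y hy => (hC y hy).trans ?_⟩ fun c hc => ?_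
    · exact mul_le_mul_of_nonneg_right (le_abs_self C) (norm_nonneg y)
    · exact (div_le_iff₀ hpos).2 (hc.2 x hx)

theorem IsDualVector.isDualVectorOn (h : IsDualVector A r) (S : Set M) : IsDualVectorOn A S r where
  map_add x _ y _ := h.map_add x y
  map_smulC c x _ := h.map_smulC c x
  map_smulA a x _ := h.map_smulA a x
  bound := h.bound.imp fun _ hC x _ => hC x

theorem IsDualVector.of_univ (h : IsDualVectorOn A Set.univ r) : IsDualVector A r :=
  ⟨fun x y => h.map_add x trivial y trivial, fun c x => h.map_smulC c x trivial,
    fun a x => h.map_smulA a x trivial, h.bound.imp fun _ hC x => hC x trivial⟩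

theorem IsDualVector.norm_apply_le (h : IsDualVector A r) (x : M) :
    ‖r x‖ ≤ dualNorm A r * ‖x‖ := by
  rw [← dualNormOn_univ]
  exact (h.isDualVectorOn Set.univ).norm_apply_le (Set.mem_univ x)

theorem IsDualVectorOn.add (hr : IsDualVectorOn A S r) (hs : IsDualVectorOn A S s) :
    IsDualVectorOn A S (fun x => r x + s x) where
  map_add x hx y hy := by rw [hr.map_add x hx y hy, hs.map_add x hx y hy]; abel
  map_smulC c x hx := by rw [hr.map_smulC c x hx, hs.map_smulC c x hx, smul_add]
  map_smulA a x hx := by rw [hr.map_smulA a x hx, hs.map_smulA a x hx, mul_add]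
  bound := by
    obtain ⟨C, hC⟩ := hr.bound
    obtain ⟨D, hD⟩ := hs.bound
    refine ⟨C + D, fun x hx => (norm_add_le _ _).trans ?_⟩
    rw [add_mul]
    exact add_le_add (hC x hx) (hD x hx)

theorem IsDualVector.add (hr : IsDualVector A r) (hs : IsDualVector A s) :
    IsDualVector A (fun x => r x + s x) :=
  .of_univ ((hr.isDualVectorOn Set.univ).add (hs.isDualVectorOn Set.univ))

theorem IsDualVectorOn.mul_right (hr : IsDualVectorOn A S r) (c : A) :
    IsDualVectorOn A S (fun x => r x * c) where
  map_add x hx y hy := by rw [hr.map_add x hx y hy, add_mul]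
  map_smulC d x hx := by rw [hr.map_smulC d x hx, smul_mul_assoc]
  map_smulA a x hx := by rw [hr.map_smulA a x hx, mul_assoc]
  bound := by
    obtain ⟨C, hC⟩ := hr.bound
    refine ⟨C * ‖c‖, fun x hx => (norm_mul_le _ _).trans ?_⟩
    rw [mul_right_comm]
    exact mul_le_mul_of_nonneg_right (hC x hx) (norm_nonneg c)

theorem IsDualVector.mul_right (hr : IsDualVector A r) (c : A) :
    IsDualVector A (fun x => r x * c) :=
  .of_univ ((hr.isDualVectorOn Set.univ).mul_right c)

/-- A bound on the unit ball of a subset stable under scalars is homogeneous. -/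
theorem IsDualVectorOn.norm_apply_le_of_unit_ball (hr : IsDualVectorOn A S r)
    (hS : ∀ (c : ℂ), ∀ x ∈ S, c • x ∈ S) {C : ℝ} (h : ∀ x ∈ S, ‖x‖ ≤ 1 → ‖r x‖ ≤ C)
    {x : M} (hx : x ∈ S) : ‖r x‖ ≤ C * ‖x‖ := by
  rcases eq_or_ne x 0 with rfl | h0
  · obtain ⟨D, hD⟩ := hr.bound
    simpa using hD 0 hx
  · have hpos : 0 < ‖x‖ := norm_pos_iff.2 h0
    have hnorm : ‖((‖x‖⁻¹ : ℝ) : ℂ)‖ = ‖x‖⁻¹ := by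
      rw [Complex.norm_real, Real.norm_of_nonneg (inv_nonneg.2 hpos.le)]
    have h1 := h _ (hS ((‖x‖⁻¹ : ℝ) : ℂ) x hx)
      (by rw [norm_smul, hnorm, inv_mul_cancel₀ hpos.ne'])
    rw [hr.map_smulC _ x hx, norm_smul, hnorm] at h1
    rwa [inv_mul_le_iff₀ hpos, mul_comm] at h1

theorem IsDualVectorOn.map_zero (hr : IsDualVectorOn A S r) (h0 : (0 : M) ∈ S) : r 0 = 0 := by
  simpa using hr.map_smulC 0 0 h0

variable [HilbertCStarModule A M]

theorem hInner_add_left (x y z : M) : hInner A (x + y) z = hInner A x z + hInner A y z :=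
  HilbertCStarModule.inner_add_left x y z

theorem hInner_smulA_left (a : A) (x y : M) : hInner A (a • x) y = a * hInner A x y :=
  HilbertCStarModule.inner_smulA_left a x y

theorem hInner_smulC_left (c : ℂ) (x y : M) : hInner A (c • x) y = c • hInner A x y :=
  HilbertCStarModule.inner_smulC_left c x y

theorem star_hInner (x y : M) : star (hInner A x y) = hInner A y x :=
  (HilbertCStarModule.inner_conj y x).symm

theorem hInner_add_right (x y z : M) : hInner A x (y + z) = hInner A x y + hInner A x z := by
  rw [← star_hInner, hInner_add_left, star_add, star_hInner, star_hInner]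

theorem hInner_smulA_right (a : A) (x y : M) : hInner A x (a • y) = hInner A x y * star a := by
  rw [← star_hInner, hInner_smulA_left, star_mul, star_hInner]

theorem hInner_smulC_right (c : ℂ) (x y : M) : hInner A x (c • y) = star c • hInner A x y := by
  rw [← star_hInner, hInner_smulC_left, star_smul, star_hInner]

theorem hInner_zero_right (x : M) : hInner A x (0 : M) = 0 := by
  simpa using hInner_smulC_right (A := A) 0 x (0 : M)

theorem norm_hInner_self (x : M) : ‖hInner A x x‖ = ‖x‖ ^ 2 := by
  rw [HilbertCStarModule.norm_eq (A := A) x, Real.sq_sqrt (norm_nonneg _), hInner]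

theorem eq_zero_of_hInner_self {x : M} (h : hInner A x x = 0) : x = 0 :=
  (HilbertCStarModule.inner_self_eq_zero x).1 h

theorem isSelfAdjoint_hInner_self (x : M) : IsSelfAdjoint (hInner A x x) :=
  star_hInner x x

variable [PartialOrder A] [StarOrderedRing A]

theorem hInner_self_nonneg (x : M) : 0 ≤ hInner A x x := by
  obtain ⟨b, hb⟩ := HilbertCStarModule.inner_self_pos (A := A) x
  rw [hInner, hb]
  exact star_mul_self_nonneg b

/-- The Cauchy–Schwarz inequality for bounded module maps into the coefficient algebra. -/
theorem IsDualVector.mul_star_le {T : M → A} (hT : IsDualVector A T) {C : ℝ}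
    (hC : ∀ x, ‖T x‖ ≤ C * ‖x‖) (x : M) : T x * star (T x) ≤ C ^ 2 • hInner A x x := by
  refine le_smul_of_norm_conjugate_le (mul_star_self_nonneg _) (hInner_self_nonneg x)
    (sq_nonneg C) fun e => ?_
  have h1 : star e * (T x * star (T x)) * e = T (star e • x) * star (T (star e • x)) := by
    rw [hT.map_smulA, star_mul, star_star]; simp only [mul_assoc]
  have h2 : star e * hInner A x x * e = hInner A (star e • x) (star e • x) := by
    rw [hInner_smulA_left, hInner_smulA_right, star_star, mul_assoc]
  rw [h1, h2, norm_hInner_self, CStarRing.norm_self_mul_star, ← pow_two, ← mul_pow]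
  exact pow_le_pow_left₀ (norm_nonneg _) (hC _) 2

/-- Subtracting an approximate projection onto the line spanned by `n`. -/
theorem exists_hInner_self_add_smul_le (x n : M) :
    ∃ (c : ℂ) (a : A), ‖n‖ ^ 2 • hInner A (x + c • a • n) (x + c • a • n) +
      hInner A x n * star (hInner A x n) ≤ ‖n‖ ^ 2 • hInner A x x := by
  rcases eq_or_ne n 0 with rfl | hn0
  · exact ⟨0, 0, by simp [hInner_zero_right]⟩
  set b := hInner A x n with hb
  set Z := ‖n‖ ^ 2 with hZ
  have hZ0 : 0 < Z := by have := norm_pos_iff.2 hn0; positivity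
  have hbs : hInner A n x = star b := (star_hInner x n).symm
  refine ⟨((-Z⁻¹ : ℝ) : ℂ), b, ?_⟩
  have hyy : hInner A (x + ((-Z⁻¹ : ℝ) : ℂ) • b • n) (x + ((-Z⁻¹ : ℝ) : ℂ) • b • n) =
      hInner A x x - (2 * Z⁻¹) • (b * star b) + (Z⁻¹ ^ 2) • (b * hInner A n n * star b) := by
    simp only [hInner_add_left, hInner_add_right, hInner_smulC_left, hInner_smulC_right,
      hInner_smulA_left, hInner_smulA_right, hbs, ← hb, Complex.star_def, Complex.conj_ofReal,
      mul_assoc]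
    simp only [Complex.coe_smul, add_mul, smul_mul_assoc, mul_assoc]
    module
  have hbz : b * hInner A n n * star b ≤ Z • (b * star b) := by
    rw [hZ, ← norm_hInner_self (A := A)]
    exact CStarAlgebra.star_right_conjugate_le_norm_smul (isSelfAdjoint_hInner_self n)
  rw [← sub_nonneg, hyy]
  refine (smul_nonneg (inv_nonneg.2 hZ0.le) (sub_nonneg.2 hbz)).trans_eq ?_
  match_scalars <;> field_simp <;> ring

theorem norm_hInner_le (x n : M) : ‖hInner A x n‖ ≤ ‖n‖ * ‖x‖ := by
  obtain ⟨c, a, h⟩ := exists_hInner_self_add_smul_le (A := A) x n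
  have h1 := (le_add_of_nonneg_left
    (smul_nonneg (sq_nonneg ‖n‖) (hInner_self_nonneg (A := A) (x + c • a • n)))).trans h
  have h2 := CStarAlgebra.norm_le_norm_of_nonneg_of_le (mul_star_self_nonneg _) h1
  rw [CStarRing.norm_self_mul_star, norm_smul, norm_hInner_self,
    Real.norm_of_nonneg (by positivity),
    ← pow_two, ← mul_pow] at h2
  exact le_of_sq_le_sq h2 (by positivity)

theorem isDualVector_toDualFun (n : M) : IsDualVector A (toDualFun A n) where
  map_add x y := hInner_add_left x y n
  map_smulC c x := hInner_smulC_left c x n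
  map_smulA a x := hInner_smulA_left a x n
  bound := ⟨‖n‖, fun x => norm_hInner_le x n⟩

/-- If `T` annihilates `n`, then `T` and `⟨·, n⟩` are orthogonal and their norms add up as in
Pythagoras' theorem. -/
theorem IsDualVector.norm_sq_add_hInner_le {T : M → A} (hT : IsDualVector A T) {C : ℝ}
    (hC0 : 0 < C) (hC : ∀ x, ‖T x‖ ≤ C * ‖x‖) {n : M} (hn : T n = 0) (x : M) :
    ‖T x + hInner A x n‖ ^ 2 ≤ (C ^ 2 + ‖n‖ ^ 2) * ‖x‖ ^ 2 := by
  rcases eq_or_ne n 0 with rfl | hn0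
  · rw [hInner_zero_right, add_zero, norm_zero, zero_pow two_ne_zero, add_zero, ← mul_pow]
    exact pow_le_pow_left₀ (norm_nonneg _) (hC x) 2
  obtain ⟨c, a, hB⟩ := exists_hInner_self_add_smul_le (A := A) x n
  have hP := hT.mul_star_le hC (x + c • a • n)
  rw [hT.map_add, hT.map_smulC, hT.map_smulA, hn, mul_zero, smul_zero, add_zero] at hP
  set b := hInner A x n
  set Z := ‖n‖ ^ 2
  have hZ0 : 0 < Z := by have := norm_pos_iff.2 hn0; positivity
  have hW := mul_star_self_nonneg (Z • T x - C ^ 2 • b)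
  have key : (T x + b) * star (T x + b) ≤ (C ^ 2 + Z) • hInner A x x := by
    rw [← sub_nonneg]
    have h1 := smul_nonneg (a := 1 + Z / C ^ 2) (by positivity) (sub_nonneg.2 hP)
    have h2 := smul_nonneg (a := 1 + C ^ 2 / Z) (by positivity) (sub_nonneg.2 hB)
    have h3 := smul_nonneg (a := (Z * C ^ 2)⁻¹) (by positivity) hW
    refine (add_nonneg (add_nonneg h1 h2) h3).trans_eq ?_
    simp only [star_add, star_sub, star_smul, star_trivial, add_mul, mul_add, sub_mul, mul_sub,
      smul_mul_assoc, mul_smul_comm]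
    match_scalars <;> field_simp <;> ring
  calc _ = ‖(T x + b) * star (T x + b)‖ := by rw [CStarRing.norm_self_mul_star, pow_two]
    _ ≤ ‖(C ^ 2 + Z) • hInner A x x‖ :=
      CStarAlgebra.norm_le_norm_of_nonneg_of_le (mul_star_self_nonneg _) key
    _ = _ := by rw [norm_smul, norm_hInner_self, Real.norm_of_nonneg (by positivity)]

theorem eq_zero_of_forall_sq_le {m C D : ℝ} (hm : 0 ≤ m) (hD : 0 < D)
    (h : ∀ t : ℝ, 0 ≤ t → ((t + D⁻¹) * m) ^ 2 ≤ (C ^ 2 + t ^ 2 * m) * m) : m = 0 := by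
  by_contra hm0
  have hpos : 0 < m := lt_of_le_of_ne hm (Ne.symm hm0)
  have h1 := h (D * C ^ 2 / m) (by positivity)
  have h2 : ((D * C ^ 2 / m + D⁻¹) * m) ^ 2 - (C ^ 2 + (D * C ^ 2 / m) ^ 2 * m) * m =
      C ^ 2 * m + (D⁻¹ * m) ^ 2 := by
    field_simp
    ring
  have h3 : 0 < C ^ 2 * m + (D⁻¹ * m) ^ 2 := by positivity
  linarith

theorem IsDualVectorOn.eq_zero_of_hInner_self_le (hN : IsHilbertSubmodule A N)
    (hr : IsDualVectorOn A N r) (hτ : IsDualVector A τ)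
    (h : ∀ v ∈ N, dualNormOn A N (fun x => r x + toDualFun A v x) ≤
      dualNorm A (fun x => τ x + toDualFun A v x))
    {n v : M} (hn : n ∈ N) (hv : v ∈ N) (hτn : τ n + hInner A n v = 0)
    {D : ℝ} (hD : 0 < D)
    (hle : hInner A n n ≤ D • (r n + hInner A n v)) : n = 0 := by
  have hT : IsDualVector A (fun x => τ x + toDualFun A v x) := hτ.add (isDualVector_toDualFun v)
  obtain ⟨C₀, hC₀⟩ := hT.bound
  set C := |C₀| + 1
  have hC0 : 0 < C := by positivity
  have hC : ∀ x, ‖τ x + toDualFun A v x‖ ≤ C * ‖x‖ := fun x => (hC₀ x).trans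
    (mul_le_mul_of_nonneg_right ((le_abs_self C₀).trans (by simp [C])) (norm_nonneg x))
  have hle' : D⁻¹ • hInner A n n ≤ r n + hInner A n v := by
    have := smul_le_smul_of_nonneg_left hle (inv_nonneg.2 hD.le)
    rwa [smul_smul, inv_mul_cancel₀ hD.ne', one_smul] at this
  suffices hm : ‖n‖ ^ 2 = 0 by simpa using hm
  refine eq_zero_of_forall_sq_le (C := C) (sq_nonneg _) hD fun t ht => ?_
  have hnorm : ‖(t : ℂ) • n‖ = t * ‖n‖ := by
    rw [norm_smul, Complex.norm_real, Real.norm_of_nonneg ht]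
  have hw : v + (t : ℂ) • n ∈ N := hN.add_mem hv (hN.smulC_mem _ hn)
  have hTn : τ ((t : ℂ) • n) + toDualFun A v ((t : ℂ) • n) = 0 := by
    rw [hT.map_smulC, toDualFun, hτn, smul_zero]
  have h1 : dualNorm A (fun x => τ x + toDualFun A (v + (t : ℂ) • n) x) ≤
      √(C ^ 2 + (t * ‖n‖) ^ 2) := by
    refine dualNorm_le (Real.sqrt_nonneg _) fun x => ?_
    have := hT.norm_sq_add_hInner_le hC0 hC hTn x
    rw [hnorm] at this
    refine le_of_sq_le_sq ?_ (by positivity)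
    rw [mul_pow, Real.sq_sqrt (by positivity)]
    simpa only [toDualFun, hInner_add_right, ← add_assoc] using this
  have h2 := (hr.add ((isDualVector_toDualFun (A := A)
    (v + (t : ℂ) • n)).isDualVectorOn N)).norm_apply_le hn
  have h3 := h2.trans (mul_le_mul_of_nonneg_right ((h _ hw).trans h1) (norm_nonneg n))
  have h4 : (t + D⁻¹) • hInner A n n ≤ r n + toDualFun A (v + (t : ℂ) • n) n := by
    rw [toDualFun, hInner_add_right, hInner_smulC_right, Complex.star_def, Complex.conj_ofReal,
      Complex.coe_smul, add_smul, ← add_assoc, add_comm]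
    exact add_le_add_left hle' _
  have h5 := CStarAlgebra.norm_le_norm_of_nonneg_of_le
    (smul_nonneg (by positivity) (hInner_self_nonneg n)) h4
  rw [norm_smul, norm_hInner_self, Real.norm_of_nonneg (by positivity)] at h5
  refine (pow_le_pow_left₀ (by positivity) (h5.trans h3) 2).trans_eq ?_
  rw [mul_pow √_, Real.sq_sqrt (by positivity), mul_pow t]

/-- If `r` on `N` and `τ` on `M` have comparable norms after every translation by `⟨·, v⟩`,
`v ∈ N`, then `τ` extends `r`. -/
theorem IsDualVectorOn.eq_of_dualNormOn_add_le (hN : IsHilbertSubmodule A N)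
    (hr : IsDualVectorOn A N r) (hτ : IsDualVector A τ)
    (h : ∀ v ∈ N, dualNormOn A N (fun x => r x + toDualFun A v x) ≤
      dualNorm A (fun x => τ x + toDualFun A v x))
    {y : M} (hy : y ∈ N) : r y = τ y := by
  set x₀ := r y - τ y with hx₀
  set z := hInner A y y with hz
  have hz0 : 0 ≤ z := hInner_self_nonneg y
  have hτ0 : τ 0 = 0 := by simpa using hτ.map_smulC 0 0
  have hsub : ∀ a : A, a • y = 0 → a * x₀ = 0 := fun a ha => by
    rw [hx₀, mul_sub, ← hr.map_smulA a y hy, ← hτ.map_smulA, ha,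
      hr.map_zero hN.zero_mem, hτ0, sub_zero]
  have hzx : z * x₀ = 0 := by
    have hε : ∀ ε : ℝ, 0 < ε → ‖z * x₀‖ ≤ ε * ‖x₀‖ := fun ε hε => by
      obtain ⟨k, j, hk, hkj, hzk, -⟩ := exists_spectral_cutoff hz0 hε
      have hkx : k * x₀ = 0 := by
        have hn : (star x₀ * (k * k)) • y = 0 := by
          have hin : hInner A ((star x₀ * (k * k)) • y) ((-1 : ℂ) • star (j * τ y) • y) =
              -(star x₀ * k * (k * z * j) * τ y) := by
            rw [hInner_smulC_right, hInner_smulA_right, hInner_smulA_left, star_star]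
            simp [mul_assoc, hz]
          have hp : r ((star x₀ * (k * k)) • y) +
              hInner A ((star x₀ * (k * k)) • y) ((-1 : ℂ) • star (j * τ y) • y) =
              star (k * x₀) * (k * x₀) := by
            rw [hin, hkj, hr.map_smulA _ y hy, star_mul, hk, hx₀]
            noncomm_ring
          refine hr.eq_zero_of_hInner_self_le hN hτ h
            (v := (-1 : ℂ) • star (j * τ y) • y) (D := ‖k * z * k‖ + 1) (hN.smulA_mem _ hy)
            (hN.smulC_mem _ (hN.smulA_mem _ hy)) ?_ (by positivity) ?_
          · rw [hin, hkj, hτ.map_smulA]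
            simp [mul_assoc]
          · have hkzk : IsSelfAdjoint (k * z * k) := by
              rw [isSelfAdjoint_iff, star_mul, star_mul, hk, (isSelfAdjoint_hInner_self y).star_eq,
                mul_assoc]
            have h1 : hInner A ((star x₀ * (k * k)) • y) ((star x₀ * (k * k)) • y) =
                star (k * x₀) * (k * z * k) * (k * x₀) := by
              rw [hInner_smulA_left, hInner_smulA_right]
              simp [mul_assoc, hz, hk]
            rw [hp, h1, add_smul, one_smul]
            exact (CStarAlgebra.star_left_conjugate_le_norm_smul hkzk).trans
              (le_add_of_nonneg_right (star_mul_self_nonneg _))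
        have := hsub _ hn
        rw [← CStarRing.star_mul_self_eq_zero_iff, star_mul, hk]
        simpa [mul_assoc] using this
      calc ‖z * x₀‖ = ‖(z - k) * x₀‖ := by rw [sub_mul, hkx, sub_zero]
        _ ≤ ‖z - k‖ * ‖x₀‖ := norm_mul_le _ _
        _ ≤ ε * ‖x₀‖ := mul_le_mul_of_nonneg_right hzk (norm_nonneg _)
    refine norm_le_zero_iff.1 (le_of_forall_pos_le_add fun δ hδ => ?_)
    refine (hε (δ / (‖x₀‖ + 1)) (by positivity)).trans ?_
    rw [zero_add, div_mul_eq_mul_div, div_le_iff₀ (by positivity)]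
    nlinarith
  have hn : star x₀ • y = 0 := by
    refine eq_zero_of_hInner_self (A := A) ?_
    rw [hInner_smulA_left, hInner_smulA_right, star_star, hzx, mul_zero]
  exact sub_eq_zero.1 (CStarRing.star_mul_self_eq_zero_iff _ |>.1 (hsub _ hn))

theorem IsDualVector.conjugate_add_le (hτ : IsDualVector A τ)
    (hN : IsHilbertSubmodule A N)
    (h : ∀ c : A, dualNorm A (fun x => τ x * c) ≤ dualNormOn A N (fun x => τ x * c))
    {x : M} (hx : x ∈ orthComp A N) (hx1 : ‖x‖ ≤ 1) {k : A} (hk : star k = k) {K : ℝ} (hK : 0 ≤ K)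
    (hvalid : ∀ y ∈ N, ‖y‖ ≤ 1 → k * (star (τ y) * τ y) * k ≤ K • (k * k))
    {y : M} (hy : y ∈ N) (hy1 : ‖y‖ ≤ 1) :
    k * (star (τ y) * τ y + star (τ x) * τ x) * k ≤ K • (k * k) := by
  have hkk : 0 ≤ k * k := by simpa [hk] using star_mul_self_nonneg k
  refine le_smul_of_norm_conjugate_le ?_ hkk hK fun e => ?_
  · have := star_left_conjugate_nonneg
      (add_nonneg (star_mul_self_nonneg (τ y)) (star_mul_self_nonneg (τ x))) k
    rwa [hk] at this
  set c := k * e with hc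
  have hcc : star e * (k * k) * e = star c * c := by simp [hc, hk, mul_assoc]
  have hτc := hτ.mul_right c
  have hcn : ∀ m, ‖τ m * c‖ ≤ √K * ‖c‖ * ‖m‖ := fun m => by
    refine (hτc.norm_apply_le m).trans (mul_le_mul_of_nonneg_right ((h c).trans ?_)
      (norm_nonneg m))
    refine dualNormOn_le (by positivity) fun y' hy' =>
      (hτc.isDualVectorOn N).norm_apply_le_of_unit_ball (fun c x hx => hN.smulC_mem c hx)
        (fun y hy hy1 => ?_) hy'
    refine le_of_sq_le_sq ?_ (by positivity)
    have h1 := star_left_conjugate_le_conjugate (hvalid y hy hy1) e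
    have h2 : star e * (k * (star (τ y) * τ y) * k) * e = star (τ y * c) * (τ y * c) := by
      simp [hc, hk, mul_assoc]
    rw [h2, mul_smul_comm, smul_mul_assoc, hcc] at h1
    have h3 := CStarAlgebra.norm_le_norm_of_nonneg_of_le (star_mul_self_nonneg _) h1
    rwa [CStarRing.norm_star_mul_self, norm_smul, CStarRing.norm_star_mul_self,
      Real.norm_of_nonneg hK, ← pow_two, ← pow_two, ← Real.sq_sqrt hK, ← mul_pow] at h3
  set u := τ y * c with hu
  set ω := τ x * c with hω
  set Q := star u * u + star ω * ω with hQ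
  have hQe : star e * (k * (star (τ y) * τ y + star (τ x) * τ x) * k) * e = Q := by
    simp [hQ, hu, hω, hc, hk, mul_assoc, mul_add, add_mul]
  have hQ0 : 0 ≤ Q := add_nonneg (star_mul_self_nonneg _) (star_mul_self_nonneg _)
  have hball : ∀ (v : M) (a : A), ‖v‖ ≤ 1 → star a * hInner A v v * a ≤ star a * a :=
    fun v a hv => (CStarAlgebra.star_left_conjugate_le_norm_smul
      (isSelfAdjoint_hInner_self v)).trans <| by
        rw [norm_hInner_self]
        exact smul_le_of_le_one_left (star_mul_self_nonneg _) (pow_le_one₀ (norm_nonneg v) hv)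
  have hxy : hInner A x y = 0 := hx y hy
  have hyx : hInner A y x = 0 := by rw [← star_hInner, hxy, star_zero]
  have hmm : hInner A (star u • y + star ω • x) (star u • y + star ω • x) ≤ Q := by
    simp only [hInner_add_left, hInner_add_right, hInner_smulA_left, hInner_smulA_right, star_star,
      hxy, hyx, mul_zero, add_zero, zero_add]
    exact add_le_add (hball y u hy1) (hball x ω hx1)
  have hQτ : τ (star u • y + star ω • x) * c = Q := by
    rw [hτ.map_add, hτ.map_smulA, hτ.map_smulA, add_mul, mul_assoc, mul_assoc]
  have h1 := hcn (star u • y + star ω • x)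
  have h2 := CStarAlgebra.norm_le_norm_of_nonneg_of_le (hInner_self_nonneg _) hmm
  rw [norm_hInner_self] at h2
  rw [hQτ] at h1
  rw [hQe, hcc, CStarRing.norm_star_mul_self]
  have h3 : ‖Q‖ ^ 2 ≤ K * (‖c‖ * ‖c‖) * ‖Q‖ := by
    refine (pow_le_pow_left₀ (norm_nonneg _) h1 2).trans ?_
    rw [mul_pow, mul_pow, Real.sq_sqrt hK, pow_two ‖c‖]
    exact mul_le_mul_of_nonneg_left h2 (by positivity)
  rcases (norm_nonneg Q).eq_or_lt with h0 | h0
  · rw [← h0]; positivity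
  · rw [pow_two] at h3
    exact le_of_mul_le_mul_right h3 h0

/-- If the norm of every `τ · c` is attained on `N`, then `τ` vanishes on the orthogonal complement
of `N`. -/
theorem IsDualVector.eq_zero_of_mem_orthComp (hτ : IsDualVector A τ)
    (hN : IsHilbertSubmodule A N)
    (h : ∀ c : A, dualNorm A (fun x => τ x * c) ≤ dualNormOn A N (fun x => τ x * c))
    {x : M} (hx : x ∈ orthComp A N) : τ x = 0 := by
  suffices hunit : ∀ x ∈ orthComp A N, ‖x‖ ≤ 1 → ‖τ x‖ ≤ 0 by
    have := (hτ.isDualVectorOn (orthComp A N)).norm_apply_le_of_unit_ball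
      (fun c x hx s hs => by rw [hInner_smulC_left, hx s hs, smul_zero]) hunit hx
    simpa using this
  intro x hx hx1
  have hτ0 : τ 0 = 0 := by simpa using hτ.map_smulC 0 0
  have hq0 : 0 ≤ star (τ x) * τ x := star_mul_self_nonneg _
  have hq : ‖star (τ x) * τ x‖ ≤ 0 := by
    refine le_of_forall_pos_le_add fun δ hδ => ?_
    obtain ⟨k, j, hk, -, hqk, hδk⟩ := exists_spectral_cutoff hq0 hδ
    have hkk : 0 ≤ k * k := by simpa [hk] using star_mul_self_nonneg k
    suffices hk0 : k = 0 by simpa [hk0] using hqk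
    by_contra hk0
    have hkk0 : k * k ≠ 0 := fun h0 => hk0 <| by
      rwa [← CStarRing.star_mul_self_eq_zero_iff, hk]
    obtain ⟨C, hC⟩ := hτ.bound
    have hiter : ∀ i : ℕ, 0 ≤ C ^ 2 - i * δ ∧ ∀ y ∈ N, ‖y‖ ≤ 1 →
        k * (star (τ y) * τ y) * k ≤ (C ^ 2 - i * δ) • (k * k) := by
      intro i
      induction i with
      | zero =>
        rw [Nat.cast_zero, zero_mul, sub_zero]
        refine ⟨sq_nonneg C, fun y hy hy1 => ?_⟩
        have h1 := CStarAlgebra.star_left_conjugate_le_norm_smul (a := k)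
          (IsSelfAdjoint.star_mul_self (τ y))
        rw [hk, CStarRing.norm_star_mul_self] at h1
        refine h1.trans (smul_le_smul_of_nonneg_right ?_ hkk)
        have h2 : ‖τ y‖ ≤ |C| := (hC y).trans <|
          (mul_le_mul_of_nonneg_right (le_abs_self C) (norm_nonneg y)).trans
            (mul_le_of_le_one_right (abs_nonneg C) hy1)
        rw [← pow_two, ← sq_abs C]
        exact pow_le_pow_left₀ (norm_nonneg _) h2 2
      | succ i ih =>
        have hstep : ∀ y ∈ N, ‖y‖ ≤ 1 →
            k * (star (τ y) * τ y) * k ≤ (C ^ 2 - (i + 1 : ℕ) * δ) • (k * k) := by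
          intro y hy hy1
          have h1 := hτ.conjugate_add_le hN h hx hx1 hk ih.1 ih.2 hy hy1
          rw [mul_add, add_mul] at h1
          have h2 := (add_le_add_right hδk (k * (star (τ y) * τ y) * k)).trans h1
          rw [← le_sub_iff_add_le, ← sub_smul] at h2
          convert h2 using 2
          push_cast
          ring
        refine ⟨?_, hstep⟩
        have h0 := hstep 0 hN.zero_mem (by simp)
        rw [hτ0, mul_zero, mul_zero, zero_mul] at h0
        by_contra hneg
        push Not at hneg
        have h1 := smul_nonneg (neg_nonneg.2 hneg.le) hkk
        rw [neg_smul, neg_nonneg] at h1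
        exact hkk0 ((smul_eq_zero.1 (le_antisymm h1 h0)).resolve_left hneg.ne)
    obtain ⟨i, hi⟩ := exists_nat_gt (C ^ 2 / δ)
    rw [div_lt_iff₀ hδ] at hi
    linarith [(hiter i).1]
  rw [CStarRing.norm_star_mul_self] at hq
  nlinarith [norm_nonneg (τ x)]

end HilbertModule

/-- STATEMENT 13: If `φ : N' → M'` is an isometric `A`-linear embedding extending the
canonical embedding of `N` into `M'`, then the image `φ(r)` of every `r ∈ N'` vanishes
on the orthogonal complement `N^⊥ ⊆ M`. -/
theorem extension_vanishes_on_orthogonal_complement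
    (A : Type u) [NonUnitalCStarAlgebra A]
    (M : Type v) [NormedAddCommGroup M] [NormedSpace ℂ M] [SMul A M] [HilbertCStarModule A M]
    (N : Set M) (hN : IsHilbertSubmodule A N)
    (φ : (M → A) → (M → A))
    (hmem : ∀ r : M → A, IsDualVectorOn A N r → IsDualVector A (φ r))
    (hcongr : ∀ r s : M → A, IsDualVectorOn A N r → IsDualVectorOn A N s →
      (∀ x ∈ N, r x = s x) → φ r = φ s)
    (hadd : ∀ r s : M → A, IsDualVectorOn A N r → IsDualVectorOn A N s →
      φ (fun x => r x + s x) = fun x => φ r x + φ s x)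
    (hsmulC : ∀ (c : ℂ) (r : M → A), IsDualVectorOn A N r →
      φ (fun x => c • r x) = fun x => c • φ r x)
    (hsmulA : ∀ (a : A) (r : M → A), IsDualVectorOn A N r →
      φ (fun x => r x * star a) = fun x => φ r x * star a)
    (hisom : ∀ r : M → A, IsDualVectorOn A N r → dualNorm A (φ r) = dualNormOn A N r)
    (hcanon : ∀ n ∈ N, φ (toDualFun A n) = toDualFun A n) :
    ∀ r : M → A, IsDualVectorOn A N r → ∀ x ∈ orthComp A N, φ r x = 0 := by
  let := CStarAlgebra.spectralOrder A
  have := CStarAlgebra.spectralOrderedRing A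
  intro r hr x hx
  have hτ := hmem r hr
  have heq : ∀ y ∈ N, r y = φ r y := fun y hy => by
    refine hr.eq_of_dualNormOn_add_le hN hτ (fun v hv => ?_) hy
    have hv' := (isDualVector_toDualFun (A := A) v).isDualVectorOn N
    rw [← hisom _ (hr.add hv'), hadd r _ hr hv', hcanon v hv]
  refine hτ.eq_zero_of_mem_orthComp hN (fun c => ?_) hx
  have hrc := hr.mul_right c
  have hφ : φ (fun x => r x * c) = fun x => φ r x * c := by
    simpa only [star_star] using hsmulA (star c) r hr
  rw [← hφ, hisom _ hrc]
  exact (dualNormOn_congr fun y hy => by rw [hφ, heq y hy]).le
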